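/- The normal coordinate ψ^{T₂} = φ^{T₂} - ½(φ^{T₁})² is finite in the toy model, with value independent of the external parameter: for every real c > 0, the limit as ε → 0⁺ of (I₂(c,ε) - ½·I₁(c,ε)²) equals π²/4. -/

import Mathlib

open MeasureTheory Real Filter

noncomputable section

/-- The toy-model integral `I₁(c,ε) = ∫₀^∞ y^{-ε}/(y+c) dy`. -/
def I1 (c ε : ℝ) : ℝ := ∫ y in Set.Ioi (0 : ℝ), y ^ (-ε) / (y + c)

/-- The nested toy-model integral of the two-vertex ladder tree,
`I₂(c,ε) = ∫₀^∞ (y^{-ε}/(y+c)) I₁(y,ε) dy`. -/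
def I2 (c ε : ℝ) : ℝ := ∫ y in Set.Ioi (0 : ℝ), (y ^ (-ε) / (y + c)) * I1 y ε

open Set in
theorem integrableOn_rpow_mul_exp_neg_mul_Ioi {s b : ℝ} (hs : -1 < s) (hb : 0 < b) :
    IntegrableOn (fun x : ℝ => x ^ s * exp (-(b * x))) (Ioi 0) := by
  simpa using integrableOn_rpow_mul_exp_neg_mul_rpow hs one_pos hb

open Set in
theorem integral_rpow_neg_mul_exp_neg_add_mul {ε t : ℝ} (c : ℝ) (h1 : ε < 1) (ht : 0 < t) :
    ∫ y in Ioi (0 : ℝ), y ^ (-ε) * exp (-((y + c) * t)) =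
      Gamma (1 - ε) * (t ^ (ε - 1) * exp (-(c * t))) := by
  have h := Real.integral_rpow_mul_exp_neg_mul_Ioi (a := 1 - ε) (by linarith) ht
  have hsplit (y : ℝ) : y ^ (-ε) * exp (-((y + c) * t)) =
      y ^ (1 - ε - 1) * exp (-(t * y)) * exp (-(c * t)) := by
    rw [mul_assoc, ← Real.exp_add]
    ring_nf
  simp_rw [hsplit]
  rw [integral_mul_const, h, one_div, Real.inv_rpow ht.le, ← Real.rpow_neg ht.le, neg_sub]
  ring

open Set in
theorem integrable_rpow_neg_mul_exp_neg_add_mul {c ε : ℝ} (hc : 0 < c) (h0 : 0 < ε)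
    (h1 : ε < 1) :
    Integrable (Function.uncurry fun y t : ℝ => y ^ (-ε) * exp (-((y + c) * t)))
      ((volume.restrict (Ioi 0)).prod (volume.restrict (Ioi 0))) := by
  have hmeas : Measurable
      (Function.uncurry fun y t : ℝ => y ^ (-ε) * exp (-((y + c) * t))) := by
    unfold Function.uncurry
    fun_prop
  rw [integrable_prod_iff' hmeas.aestronglyMeasurable]
  constructor
  · filter_upwards [ae_restrict_mem measurableSet_Ioi] with t ht
    refine ((integrableOn_rpow_mul_exp_neg_mul_Ioi (s := -ε) (by linarith) ht).mul_const
      (exp (-(c * t)))).congr (Eventually.of_forall fun y => ?_)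
    simp only [Function.uncurry_apply_pair]
    rw [mul_assoc, ← Real.exp_add]
    ring_nf
  · refine ((integrableOn_rpow_mul_exp_neg_mul_Ioi (s := ε - 1) (by linarith) hc).const_mul
      (Gamma (1 - ε))).congr ?_
    filter_upwards [ae_restrict_mem measurableSet_Ioi] with t ht
    rw [← integral_rpow_neg_mul_exp_neg_add_mul c h1 ht]
    refine setIntegral_congr_fun measurableSet_Ioi fun y hy => ?_
    have hy' : (0 : ℝ) < y := hy
    exact (Real.norm_of_nonneg (by positivity)).symm

open Set in
theorem I1_eq {c ε : ℝ} (hc : 0 < c) (h0 : 0 < ε) (h1 : ε < 1) :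
    I1 c ε = c ^ (-ε) * (π / sin (π * ε)) := by
  have hinner : ∀ y ∈ Ioi (0 : ℝ),
      y ^ (-ε) / (y + c) = ∫ t in Ioi (0 : ℝ), y ^ (-ε) * exp (-((y + c) * t)) := by
    intro y hy
    have hyc : 0 < y + c := add_pos hy hc
    simp_rw [integral_const_mul, ← neg_mul]
    rw [integral_exp_mul_Ioi (neg_neg_of_pos hyc)]
    rw [mul_zero, Real.exp_zero, neg_div_neg_eq, mul_one_div]
  rw [I1, setIntegral_congr_fun measurableSet_Ioi hinner,
    integral_integral_swap (integrable_rpow_neg_mul_exp_neg_add_mul hc h0 h1),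
    setIntegral_congr_fun measurableSet_Ioi fun t ht =>
      integral_rpow_neg_mul_exp_neg_add_mul c h1 ht,
    integral_const_mul, Real.integral_rpow_mul_exp_neg_mul_Ioi h0 hc,
    ← Real.Gamma_mul_Gamma_one_sub, one_div, Real.inv_rpow hc.le, ← Real.rpow_neg hc.le]
  ring

open Set in
theorem I2_eq {c ε : ℝ} (hc : 0 < c) (h0 : 0 < ε) (h1 : ε < 1 / 2) :
    I2 c ε = π / sin (π * ε) * (c ^ (-(2 * ε)) * (π / sin (π * (2 * ε)))) := by
  rw [← I1_eq hc (by linarith : 0 < 2 * ε) (by linarith), I1, ← integral_const_mul, I2]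
  refine setIntegral_congr_fun measurableSet_Ioi fun y hy => ?_
  have hy' : (0 : ℝ) < y := hy
  rw [I1_eq hy' h0 (by linarith), two_mul, neg_add, Real.rpow_add hy']
  ring

theorem I2_sub_half_I1_sq {c ε : ℝ} (hc : 0 < c) (h0 : 0 < ε) (h1 : ε < 1 / 2) :
    I2 c ε - (1 / 2) * (I1 c ε) ^ 2 =
      c ^ (-(2 * ε)) * (π ^ 2 / (2 * cos (π * ε) * (1 + cos (π * ε)))) := by
  have hpos : 0 < π * ε := mul_pos pi_pos h0
  have hlt : π * ε < π / 2 := by nlinarith [pi_pos]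
  have hs : 0 < sin (π * ε) := sin_pos_of_pos_of_lt_pi hpos (by linarith [pi_pos])
  have hcos : 0 < cos (π * ε) := cos_pos_of_mem_Ioo ⟨by linarith, hlt⟩
  have hcos' : 0 < 1 + cos (π * ε) := by linarith
  rw [I2_eq hc h0 h1, I1_eq hc h0 (by linarith), mul_left_comm π 2 ε, sin_two_mul,
    two_mul ε, neg_add, Real.rpow_add hc]
  have hsq := sin_sq_add_cos_sq (π * ε)
  field_simp
  linear_combination -hsq

/-- The normal coordinate `ψ^{T₂} = φ^{T₂} - ½(φ^{T₁})²` is finite in the toy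
model, with value independent of the external parameter:
`I₂(c,ε) - ½ I₁(c,ε)² → π²/4` as `ε → 0⁺`, for every `c > 0`. -/
theorem toy_model_psi2_finite (c : ℝ) (hc : 0 < c) :
    Tendsto (fun ε : ℝ => I2 c ε - (1 / 2) * (I1 c ε) ^ 2)
      (nhdsWithin 0 (Set.Ioi 0)) (nhds (π ^ 2 / 4)) := by
  have hcont : ContinuousAt (fun ε : ℝ =>
      c ^ (-(2 * ε)) * (π ^ 2 / (2 * cos (π * ε) * (1 + cos (π * ε))))) 0 := by
    refine ContinuousAt.mul (ContinuousAt.rpow (by fun_prop) (by fun_prop) (Or.inl hc.ne'))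
      (ContinuousAt.div (by fun_prop) (by fun_prop) ?_)
    norm_num
  have hlim := hcont.tendsto.mono_left (nhdsWithin_le_nhds (s := Set.Ioi 0))
  norm_num at hlim
  refine hlim.congr' ?_
  filter_upwards [Ioo_mem_nhdsGT (show (0 : ℝ) < 1 / 2 by norm_num)] with ε hε
  rw [I2_sub_half_I1_sq hc hε.1 hε.2]

end
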